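/- For every odd integer n ≥ 3, the polynomial f_n(x) (the minimal polynomial over ℚ of −1/(2 + 2cos(π/n)), rescaled to have constant coefficient 1) is unicyclic: writing f_n(x) = Σ_i p_i x^i, all p_i are non-negative integers, p_0 = 1, and p_2 = C(p_1, 2) − p_1. -/

import Mathlib

open Polynomial SimpleGraph

/-- A finset of vertices is independent if no two of its vertices are adjacent. -/
def SimpleGraph.IsIndepFinset {V : Type*} (G : SimpleGraph V) (s : Finset V) : Prop :=
  ∀ v ∈ s, ∀ w ∈ s, ¬ G.Adj v w

open scoped Classical in
/-- The independence polynomial `I(G,x) = Σ_k i_k(G) xᵏ` of a finite simple graph,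
regarded as a polynomial with rational coefficients. -/
noncomputable def SimpleGraph.indepPoly {V : Type*} [Fintype V] (G : SimpleGraph V) :
    Polynomial ℚ :=
  ∑ s : Finset V, if G.IsIndepFinset s then (X : Polynomial ℚ) ^ s.card else 0

/-- `fPoly m` : the minimal polynomial over `ℚ` of `-1/(2 + 2cos(π/m))`, rescaled so
that its constant coefficient is `1`. -/
noncomputable def fPoly (m : ℕ) : Polynomial ℚ :=
  C ((minpoly ℚ (-1 / (2 + 2 * Real.cos (Real.pi / m)))).coeff 0)⁻¹ *
    minpoly ℚ (-1 / (2 + 2 * Real.cos (Real.pi / m)))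

/-- A polynomial `p(x) = Σ_i p_i xⁱ` is unicyclic if all its coefficients are
non-negative integers, `p_0 = 1`, and `p_2 = C(p_1, 2) - p_1`. -/
def IsUnicyclicPoly (p : Polynomial ℚ) : Prop :=
  (∀ i, ∃ k : ℕ, p.coeff i = (k : ℚ)) ∧ p.coeff 0 = 1 ∧
    p.coeff 2 = p.coeff 1 * (p.coeff 1 - 1) / 2 - p.coeff 1

lemma aux_coeff_succ (z : ℂ) (P : Polynomial ℂ) (i : ℕ) :
    ((1 + C z * X) * P).coeff (i+1) = P.coeff (i+1) + z * P.coeff i := by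
  rw [add_mul, one_mul, mul_assoc, coeff_add, coeff_C_mul, coeff_X_mul]

lemma aux_coeff_zero (z : ℂ) (P : Polynomial ℂ) :
    ((1 + C z * X) * P).coeff 0 = P.coeff 0 := by
  rw [mul_coeff_zero]; simp

lemma aux_newton (Z : Finset ℂ) :
    (∏ z ∈ Z, (1 + C z * X)).coeff 0 = 1 ∧ (∏ z ∈ Z, (1 + C z * X)).coeff 1 = ∑ z ∈ Z, z ∧
    2 * (∏ z ∈ Z, (1 + C z * X)).coeff 2 = (∑ z ∈ Z, z)^2 - ∑ z ∈ Z, z^2 := by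
  induction Z using Finset.induction_on with
  | empty => simp [coeff_one]
  | insert a s ha ih =>
    obtain ⟨h0, h1, h2⟩ := ih
    rw [Finset.prod_insert ha, Finset.sum_insert ha, Finset.sum_insert ha]
    refine ⟨by rw [aux_coeff_zero, h0], ?_, ?_⟩
    · rw [aux_coeff_succ a _ 0, h0, h1]; ring
    · rw [aux_coeff_succ a _ 1, h1, mul_add, h2]; ring

lemma aux_int (Z : Finset ℂ) (hZ : ∀ z ∈ Z, IsIntegral ℤ z ∧ ∃ r : ℝ, 0 ≤ r ∧ z = r) (i : ℕ) :
    IsIntegral ℤ ((∏ z ∈ Z, (1 + C z * X)).coeff i) ∧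
      ∃ r : ℝ, 0 ≤ r ∧ (∏ z ∈ Z, (1 + C z * X)).coeff i = (r : ℂ) := by
  induction Z using Finset.induction_on generalizing i with
  | empty =>
    simp only [Finset.prod_empty, coeff_one]
    split_ifs
    · exact ⟨isIntegral_one, 1, by simp, by simp⟩
    · exact ⟨isIntegral_zero, 0, by simp, by simp⟩
  | insert a s ha ih =>
    rw [Finset.prod_insert ha]
    have ih' := ih (fun z hz => hZ z (Finset.mem_insert_of_mem hz))
    obtain ⟨ha1, r, hr, hr'⟩ := hZ a (Finset.mem_insert_self _ _)
    cases i with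
    | zero => rw [aux_coeff_zero]; exact ih' 0
    | succ i =>
      rw [aux_coeff_succ]
      obtain ⟨h1, r1, h2, h3⟩ := ih' i
      obtain ⟨h1', r1', h2', h3'⟩ := ih' (i+1)
      exact ⟨h1'.add (ha1.mul h1), r1' + r * r1, by positivity, by rw [h3, h3', hr']; push_cast; ring⟩

lemma aux_unicyclic (f : Polynomial ℚ) (Z : Finset ℂ)
    (hf : f.map (algebraMap ℚ ℂ) = ∏ z ∈ Z, (1 + C z * X))
    (hZ : ∀ z ∈ Z, IsIntegral ℤ z ∧ ∃ r : ℝ, 0 ≤ r ∧ z = r)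
    (hg : Z.image (fun z => 4 * z - z^2) = Z) : IsUnicyclicPoly f := by
  obtain ⟨h0, h1, h2⟩ := aux_newton Z
  have hi := aux_int Z hZ
  rw [← hf] at h0 h1 h2 hi
  simp only [coeff_map] at h0 h1 h2 hi
  have hs : ∑ z ∈ Z, z^2 = 3 * ∑ z ∈ Z, z := by
    have hinj : Set.InjOn (fun z : ℂ => 4 * z - z^2) Z := by
      apply Finset.injOn_of_card_image_eq
      rw [hg]
    have : ∑ z ∈ Z, z = ∑ z ∈ Z, (4 * z - z^2) := by
      conv_lhs => rw [← hg]
      rw [Finset.sum_image hinj]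
    rw [Finset.sum_sub_distrib, ← Finset.mul_sum] at this
    linear_combination this
  refine ⟨fun i => ?_, ?_, ?_⟩
  · obtain ⟨hI, r, hr, hr'⟩ := hi i
    have hI' : IsIntegral ℤ (f.coeff i) :=
      (isIntegral_algebraMap_iff (algebraMap ℚ ℂ).injective).1 hI
    obtain ⟨k, hk⟩ := IsIntegrallyClosed.isIntegral_iff.1 hI'
    have hk' : f.coeff i = (k : ℚ) := by rw [← hk]; simp
    have : ((f.coeff i : ℝ) : ℂ) = (r : ℂ) := by rw [← hr']; simp
    have h3 : (f.coeff i : ℝ) = r := Complex.ofReal_injective this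
    rw [hk'] at h3
    have : (0:ℤ) ≤ k := by
      rw [← h3] at hr
      exact_mod_cast hr
    lift k to ℕ using this
    exact ⟨k, by rw [hk']; simp⟩
  · exact (algebraMap ℚ ℂ).injective (by rw [h0]; simp)
  · apply (algebraMap ℚ ℂ).injective
    rw [hs, ← h1] at h2
    have : (2:ℂ) = algebraMap ℚ ℂ 2 := by simp
    simp only [map_sub, map_div₀, map_mul, map_one, ← this]
    linear_combination h2 / 2

lemma aux_roots (n : ℕ) (K : Type) [Field K] [Algebra ℚ K] [NeZero n] [IsCyclotomicExtension {n} ℚ K] (hn : 3 ≤ n) (β : ℝ) (w : ℂ) (hw : IsPrimitiveRoot w n)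
    (hβ : (β : ℂ) = -1 / (2 - w - w⁻¹)) (b : ℂ) :
    b ∈ ((minpoly ℚ β).map (algebraMap ℚ ℂ)).roots ↔
      ∃ v : ℂ, IsPrimitiveRoot v n ∧ b = -1 / (2 - v - v⁻¹) := by
  have : FiniteDimensional ℚ K := IsCyclotomicExtension.finite_of_singleton n ℚ K
  have hζ : IsPrimitiveRoot (IsCyclotomicExtension.zeta n ℚ (K)) n :=
    IsCyclotomicExtension.zeta_spec n ℚ (K)
  set ζ := IsCyclotomicExtension.zeta n ℚ (K)
  let e := hζ.embeddingsEquivPrimitiveRoots ℂ (cyclotomic.irreducible_rat (by omega : 0 < n))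
  have he : ∀ ψ : K →ₐ[ℚ] ℂ, ((e ψ : ℂ)) = ψ ζ := fun ψ => by
    simp [e]
  have hsurj : ∀ v : ℂ, IsPrimitiveRoot v n → ∃ ψ : K →ₐ[ℚ] ℂ, ψ ζ = v := fun v hv => by
    refine ⟨e.symm ⟨v, (mem_primitiveRoots (by omega)).2 hv⟩, ?_⟩
    rw [← he]; simp
  have hψ : ∀ ψ : K →ₐ[ℚ] ℂ, ψ (-1 / (2 - ζ - ζ⁻¹)) = -1 / (2 - ψ ζ - (ψ ζ)⁻¹) := fun ψ => by
    have h2 : ψ 2 = 2 := map_ofNat ψ 2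
    simp [h2]
  have hmin : minpoly ℚ β = minpoly ℚ (-1 / (2 - ζ - ζ⁻¹)) := by
    obtain ⟨ψ, h⟩ := hsurj w hw
    rw [← minpoly.algHom_eq ψ ψ.injective, hψ, h, ← hβ]
    exact (minpoly.algebraMap_eq (B := ℝ) (B' := ℂ) Complex.ofReal_injective β).symm
  have hr := Algebra.IsAlgebraic.range_eval_eq_rootSet_minpoly (F := ℚ) (K := K) ℂ (-1 / (2 - ζ - ζ⁻¹))
  have : b ∈ ((minpoly ℚ β).map (algebraMap ℚ ℂ)).roots ↔ b ∈ (minpoly ℚ β).rootSet ℂ := by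
    simp [rootSet, aroots]
  rw [this, hmin, ← hr]
  constructor
  · rintro ⟨ψ, rfl⟩
    exact ⟨ψ ζ, hζ.map_of_injective ψ.injective, hψ ψ⟩
  · rintro ⟨v, hv, rfl⟩
    obtain ⟨ψ, h⟩ := hsurj v hv
    exact ⟨ψ, by simp only [hψ, h]⟩

lemma aux_unit (n : ℕ) (hn : 3 ≤ n) (v : ℂ) (hv : IsPrimitiveRoot v n) :
    IsIntegral ℤ (2 - v - v⁻¹) ∧ (∃ r : ℝ, 0 ≤ r ∧ (2 - v - v⁻¹) = r) ∧ 2 - v - v⁻¹ ≠ 0 := by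
  have hv0 : v ≠ 0 := hv.ne_zero (by omega)
  have hnorm : ‖v‖ = 1 := hv.norm'_eq_one (by omega)
  refine ⟨?_, ⟨2 - 2 * v.re, ?_, ?_⟩, ?_⟩
  · have h2 : IsIntegral ℤ (2:ℂ) := by
      simpa using (isIntegral_algebraMap (R := ℤ) (A := ℂ) (x := 2))
    exact (h2.sub (hv.isIntegral (by omega))).sub (hv.inv.isIntegral (by omega))
  · have := Complex.re_le_norm v
    linarith
  · rw [Complex.inv_eq_conj hnorm, sub_sub, Complex.add_conj]; push_cast; ring
  · intro h
    have : (v - 1)^2 = 0 := by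
      field_simp at h
      linear_combination -h
    have h1 : v = 1 := by
      have := pow_eq_zero_iff (two_ne_zero) |>.1 this
      linear_combination this
    exact hv.ne_one (by omega) h1

/-- For every odd `n ≥ 3`, the polynomial `f_n(x)` is unicyclic. -/
theorem fPoly_unicyclic (n : ℕ) (hn : 3 ≤ n) (hodd : Odd n) :
    IsUnicyclicPoly (fPoly n) := by
  classical
  obtain ⟨m, hm⟩ := hodd
  set β : ℝ := -1 / (2 + 2 * Real.cos (Real.pi / n)) with hβdef
  have hn0 : (n : ℂ) ≠ 0 := by exact_mod_cast (by omega : n ≠ 0)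
  obtain ⟨w, hw, hwβ⟩ : ∃ w : ℂ, IsPrimitiveRoot w n ∧ (β : ℂ) = -1 / (2 - w - w⁻¹) := by
    have hcop : Nat.Coprime (m+1) n := by
      rw [hm, show 2 * m + 1 = (m+1) + m by ring]
      simp
    refine ⟨_, Complex.isPrimitiveRoot_exp_of_coprime (m+1) n (by omega) hcop, ?_⟩
    have : 2 * (Real.pi:ℂ) * Complex.I * (((m+1 : ℕ) : ℂ) / n) =
        (Real.pi / n : ℂ) * Complex.I + Real.pi * Complex.I := by
      have : (n : ℂ) = 2 * m + 1 := by rw [hm]; push_cast; ring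
      field_simp
      rw [this]; push_cast; ring
    rw [this, Complex.exp_add, Complex.exp_pi_mul_I, hβdef]
    push_cast
    rw [Complex.two_cos, mul_neg_one, inv_neg, ← Complex.exp_neg]
    congr 1
    ring_nf
  have : NeZero n := ⟨by omega⟩
  have : NeZero ((n : ℕ) : ℚ) := ⟨by exact_mod_cast (by omega : n ≠ 0)⟩
  let iA : Algebra ℚ (CyclotomicField n ℚ) := CyclotomicField.algebra n ℚ
  have : IsCyclotomicExtension {n} ℚ (CyclotomicField n ℚ) :=
    CyclotomicField.isCyclotomicExtension n ℚ
  have hroots := aux_roots n (CyclotomicField n ℚ) hn β w hw hwβ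
  have hint : IsIntegral ℚ β := by
    by_contra h
    have := (hroots β).2 ⟨w, hw, hwβ⟩
    rw [minpoly.eq_zero h] at this
    simp at this
  set P := (minpoly ℚ β).map (algebraMap ℚ ℂ) with hP
  have hPmonic : P.Monic := (minpoly.monic hint).map _
  have hnodup : P.roots.Nodup :=
    nodup_roots ((minpoly.irreducible hint).separable.map)
  set S := P.roots.toFinset with hS
  have hPprod : P = ∏ b ∈ S, (X - C b) := by
    conv_lhs => rw [(IsAlgClosed.splits P).eq_prod_roots_of_monic hPmonic]
    rw [Finset.prod, hS, Multiset.toFinset_val, hnodup.dedup]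
  have hmem : ∀ b, b ∈ S ↔ ∃ v : ℂ, IsPrimitiveRoot v n ∧ b = -1 / (2 - v - v⁻¹) := by
    intro b; rw [hS, Multiset.mem_toFinset, hroots]
  have hne : ∀ b ∈ S, b ≠ 0 := by
    intro b hb
    obtain ⟨v, hv, rfl⟩ := (hmem b).1 hb
    exact div_ne_zero (by simp) (aux_unit n hn v hv).2.2
  let Z := S.image (fun b => -1 / b)
  have hZmem : ∀ z, z ∈ Z ↔ ∃ v : ℂ, IsPrimitiveRoot v n ∧ z = 2 - v - v⁻¹ := by
    intro z
    simp only [Z, Finset.mem_image, hmem]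
    constructor
    · rintro ⟨b, ⟨v, hv, rfl⟩, rfl⟩
      have := (aux_unit n hn v hv).2.2
      exact ⟨v, hv, by rw [div_div_eq_mul_div]; ring⟩
    · rintro ⟨v, hv, rfl⟩
      exact ⟨_, ⟨v, hv, rfl⟩, by rw [div_div_eq_mul_div]; ring⟩
  apply aux_unicyclic (fPoly n) Z
  · have hinj : Set.InjOn (fun b : ℂ => -1 / b) S := by
      intro a _ b _ h
      simpa [neg_div] using h
    have h1 : ∏ z ∈ Z, (1 + C z * X) = ∏ b ∈ S, (1 + C (-1 / b) * X) := by
      rw [Finset.prod_image hinj]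
    have h2 : P = C (∏ b ∈ S, (-b)) * ∏ b ∈ S, (1 + C (-1 / b) * X) := by
      rw [hPprod, map_prod, ← Finset.prod_mul_distrib]
      refine Finset.prod_congr rfl fun b hb => ?_
      have := hne b hb
      rw [mul_add, ← mul_assoc, ← C_mul]
      have h3 : -b * (-1 / b) = 1 := by field_simp
      rw [h3]; simp; ring
    have hc : P.coeff 0 = ∏ b ∈ S, (-b) := by
      rw [hPprod, coeff_zero_prod]; simp
    have hc0 : ∏ b ∈ S, (-b) ≠ 0 := Finset.prod_ne_zero_iff.2 fun b hb => neg_ne_zero.2 (hne b hb)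
    have hf : (fPoly n).map (algebraMap ℚ ℂ) = C (P.coeff 0)⁻¹ * P := by
      rw [hP, coeff_map, fPoly, Polynomial.map_mul, map_C, map_inv₀]
    rw [hf, h1, hc]
    conv_lhs => rw [h2]
    rw [← mul_assoc, ← C_mul, inv_mul_cancel₀ hc0]; simp
  · intro z hz
    obtain ⟨v, hv, rfl⟩ := (hZmem z).1 hz
    have := aux_unit n hn v hv
    exact ⟨this.1, this.2.1⟩
  · have hid : ∀ v : ℂ, IsPrimitiveRoot v n →
        4 * (2 - v - v⁻¹) - (2 - v - v⁻¹)^2 = 2 - v^2 - (v^2)⁻¹ := by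
      intro v hv
      have hv0 : v ≠ 0 := hv.ne_zero (by omega)
      field_simp
      ring
    have hcop2 : Nat.Coprime 2 n := by rw [hm]; simp
    ext z
    simp only [Finset.mem_image, hZmem]
    constructor
    · rintro ⟨_, ⟨v, hv, rfl⟩, rfl⟩
      exact ⟨v^2, hv.pow_of_coprime 2 hcop2, hid v hv⟩
    · rintro ⟨v, hv, rfl⟩
      have hcop : Nat.Coprime (m+1) n := by
        rw [hm, show 2 * m + 1 = (m+1) + m by ring]
        simp
      have hv' := hv.pow_of_coprime (m+1) hcop
      have hsq : (v^(m+1))^2 = v := by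
        rw [← pow_mul, show (m+1)*2 = n + 1 by omega, pow_succ, hv.pow_eq_one, one_mul]
      exact ⟨_, ⟨_, hv', rfl⟩, by rw [hid _ hv', hsq]⟩
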